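/- (Corollary 4.1, L_p inequality for isotropic constants.) Let n ≥ 1 and p ∈ [1,∞), and let K₀, K₁ ∈ 𝒦ⁿₒ be origin-symmetric convex bodies. Then V_n(K₀ +_p K₁)^{p/n} · L_{K₀+_pK₁}^{2p/(n+2)} ≥ V_n(K₀)^{p/n} · L_{K₀}^{2p/(n+2)} + V_n(K₁)^{p/n} · L_{K₁}^{2p/(n+2)}, where for an origin-symmetric convex body K the isotropic constant L_K ≥ 0 is defined by L_K² = (1/n)·inf{ I(TK)/V_n(K)^{(n+2)/n} : T a linear map of ℝⁿ with det T = 1 }, and I(K) = ∫_K |x - c_K|² dx with c_K the centroid of K. -/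

import Mathlib

open scoped Pointwise RealInnerProductSpace

/-- A convex body in `ℝⁿ`: a compact convex set with nonempty interior. -/
def IsConvexBody {n : ℕ} (K : Set (EuclideanSpace ℝ (Fin n))) : Prop :=
  IsCompact K ∧ Convex ℝ K ∧ (interior K).Nonempty

/-- A convex body containing the origin in its interior. -/
def IsConvexBodyO {n : ℕ} (K : Set (EuclideanSpace ℝ (Fin n))) : Prop :=
  IsCompact K ∧ Convex ℝ K ∧ (0 : EuclideanSpace ℝ (Fin n)) ∈ interior K

/-- The support function of a set: `h_K(u) = sup { ⟪x, u⟫ : x ∈ K }`. -/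
noncomputable def supp {n : ℕ} (K : Set (EuclideanSpace ℝ (Fin n)))
    (u : EuclideanSpace ℝ (Fin n)) : ℝ :=
  sSup ((fun x => ⟪x, u⟫) '' K)

open MeasureTheory

/-- The centroid of a set: `c_K = (1/V_n(K)) ∫_K x dx`. -/
noncomputable def centroid {n : ℕ} (K : Set (EuclideanSpace ℝ (Fin n))) :
    EuclideanSpace ℝ (Fin n) :=
  (volume K).toReal⁻¹ • ∫ x in K, x

/-- The moment of inertia of a set: `I(K) = ∫_K |x - c_K|² dx`. -/
noncomputable def inertia {n : ℕ} (K : Set (EuclideanSpace ℝ (Fin n))) : ℝ :=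
  ∫ x in K, ‖x - centroid K‖ ^ 2

/-- The isotropic constant `L_K ≥ 0` of a convex body, defined by
`L_K² = (1/n) · inf { I(TK) / V_n(K)^{(n+2)/n} : T ∈ SL(n) }`. -/
noncomputable def isotropicConst {n : ℕ} (K : Set (EuclideanSpace ℝ (Fin n))) : ℝ :=
  Real.sqrt ((1 / (n : ℝ)) *
    sInf {r : ℝ | ∃ T : EuclideanSpace ℝ (Fin n) →ₗ[ℝ] EuclideanSpace ℝ (Fin n),
      LinearMap.det T = 1 ∧
        r = inertia (T '' K) / (volume K).toReal ^ (((n : ℝ) + 2) / n)})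

open scoped ENNReal Pointwise

lemma bm_compact {A B C : Set ℝ} (hA : IsCompact A) (hB : IsCompact B) (hA' : A.Nonempty)
    (hB' : B.Nonempty) (h : ∀ x ∈ A, ∀ y ∈ B, x + y ∈ C) : volume A + volume B ≤ volume C := by
  obtain ⟨a, ha, hamax⟩ := hA.exists_isGreatest hA'
  obtain ⟨b, hb, hbmin⟩ := hB.exists_isLeast hB'
  have h1 : volume A = volume ((fun x => x + (-b)) ⁻¹' A) := (measure_preimage_add_right _ _ _).symm
  have h2 : volume B = volume ((fun x => x + (-a)) ⁻¹' B) := (measure_preimage_add_right _ _ _).symm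
  rw [h1, h2, ← measure_union₀]
  · apply measure_mono
    rintro x (hx | hx)
    · have := h _ hx b hb
      simpa using this
    · have := h a ha _ hx
      simpa using this
  · exact (hB.measurableSet.preimage (by fun_prop)).nullMeasurableSet
  · refine measure_mono_null (t := {a + b}) ?_ (by simp)
    rintro x ⟨hx1, hx2⟩
    have e1 := hamax hx1
    have e2 := hbmin hx2
    simp only [Set.mem_singleton_iff]
    linarith

lemma enn_add_le {x y c : ℝ≥0∞} (hx : x ≠ 0) (hy : y ≠ 0)
    (h : ∀ r < x, ∀ s < y, r + s ≤ c) : x + y ≤ c := by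
  have h1 : ∀ r < x, r + y ≤ c := by
    intro r hr
    have hrt : r ≠ ∞ := (lt_top_of_lt hr).ne
    have hrc : r ≤ c := by simpa using h r hr 0 (pos_iff_ne_zero.2 hy)
    have : y ≤ c - r := le_of_forall_lt_imp_le_of_dense fun s hs =>
      ENNReal.le_sub_of_add_le_left hrt (h r hr s hs)
    exact add_le_of_le_tsub_left_of_le hrc this
  by_cases hyt : y = ∞
  · have := h1 0 (pos_iff_ne_zero.2 hx)
    simp only [hyt, zero_add, top_le_iff] at this
    simp [this]
  have hyc : y ≤ c := by simpa using h1 0 (pos_iff_ne_zero.2 hx)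
  have : x ≤ c - y := le_of_forall_lt_imp_le_of_dense fun r hr =>
      ENNReal.le_sub_of_add_le_right hyt (h1 r hr)
  exact add_le_of_le_tsub_right_of_le hyc this

lemma bm_one {A B C : Set ℝ} (hA : MeasurableSet A) (hB : MeasurableSet B) (hA' : A.Nonempty)
    (hB' : B.Nonempty) (h : ∀ x ∈ A, ∀ y ∈ B, x + y ∈ C) : volume A + volume B ≤ volume C := by
  obtain ⟨a, ha⟩ := hA'
  obtain ⟨b, hb⟩ := hB'
  have key1 : volume A ≤ volume C := by
    rw [← measure_preimage_add_right volume (-b) A]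
    refine measure_mono fun x hx => ?_
    simpa using h _ hx b hb
  have key2 : volume B ≤ volume C := by
    rw [← measure_preimage_add_right volume (-a) B]
    refine measure_mono fun x hx => ?_
    simpa using h a ha _ hx
  by_cases hA0 : volume A = 0
  · simpa [hA0] using key2
  by_cases hB0 : volume B = 0
  · simpa [hB0] using key1
  refine enn_add_le hA0 hB0 fun r hr s hs => ?_
  obtain ⟨K, hKA, hK, hrK⟩ := hA.exists_lt_isCompact hr
  obtain ⟨L, hLB, hL, hsL⟩ := hB.exists_lt_isCompact hs
  refine (add_le_add hrK.le hsL.le).trans (bm_compact hK hL ?_ ?_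
    fun x hx y hy => h x (hKA hx) y (hLB hy))
  · exact nonempty_of_measure_ne_zero (pos_of_gt hrK).ne'
  · exact nonempty_of_measure_ne_zero (pos_of_gt hsL).ne'

lemma bm_weight {A B C : Set ℝ} (hA : MeasurableSet A) (hB : MeasurableSet B) (hA' : A.Nonempty)
    (hB' : B.Nonempty) {a b : ℝ} (ha : 0 < a) (hb : 0 < b)
    (h : ∀ x ∈ A, ∀ y ∈ B, a * x + b * y ∈ C) :
    ENNReal.ofReal a * volume A + ENNReal.ofReal b * volume B ≤ volume C := by
  have e1 := Measure.addHaar_smul (volume : Measure ℝ) a A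
  have e2 := Measure.addHaar_smul (volume : Measure ℝ) b B
  simp only [Module.finrank_self, pow_one, abs_of_pos ha, abs_of_pos hb] at e1 e2
  rw [← e1, ← e2]
  apply bm_one (hA.const_smul₀ a) (hB.const_smul₀ b) hA'.smul_set hB'.smul_set
  rintro _ ⟨x, hx, rfl⟩ _ ⟨y, hy, rfl⟩
  exact h x hx y hy

lemma ennreal_amgm {a b : ℝ} (ha : 0 < a) (hb : 0 < b) (hab : a + b = 1) (x y : ℝ≥0∞) :
    x ^ a * y ^ b ≤ ENNReal.ofReal a * x + ENNReal.ofReal b * y := by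
  induction x with
  | top => simp [ENNReal.mul_top, ha]
  | coe x =>
    induction y with
    | top => simp [ENNReal.mul_top, hb]
    | coe y =>
      rw [← ENNReal.coe_rpow_of_nonneg _ ha.le, ← ENNReal.coe_rpow_of_nonneg _ hb.le]
      have := NNReal.geom_mean_le_arith_mean2_weighted ⟨a, ha.le⟩ ⟨b, hb.le⟩ x y (by ext; exact hab)
      rw [ENNReal.ofReal_eq_coe_nnreal ha.le, ENNReal.ofReal_eq_coe_nnreal hb.le]
      exact_mod_cast this

lemma layer_enn {f : ℝ → ℝ≥0∞} (hf : Measurable f) (hf1 : ∀ x, f x ≤ 1) :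
    ∫⁻ x, f x = ∫⁻ t in Set.Ioi (0:ℝ), volume {x | ENNReal.ofReal t < f x} := by
  have hfin : ∀ x, f x ≠ ∞ := fun x => ((hf1 x).trans_lt ENNReal.one_lt_top).ne
  have := lintegral_eq_lintegral_meas_lt (volume : Measure ℝ) (f := fun x => (f x).toReal)
    (Filter.Eventually.of_forall fun x => ENNReal.toReal_nonneg) hf.ennreal_toReal.aemeasurable
  simp only [ENNReal.ofReal_toReal (hfin _)] at this
  rw [this]
  refine setLIntegral_congr_fun measurableSet_Ioi fun t ht => ?_
  congr 1
  ext x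
  simp only [Set.mem_ofPred_eq]
  rw [ENNReal.ofReal_lt_iff_lt_toReal (le_of_lt ht) (hfin x)]

lemma pl_norm {f g h : ℝ → ℝ≥0∞} (hf : Measurable f) (hg : Measurable g) (hh : Measurable h)
    {a b : ℝ} (ha : 0 < a) (hb : 0 < b) (hab : a + b = 1)
    (hf1 : ⨆ x, f x = 1) (hg1 : ⨆ x, g x = 1) 
    (H : ∀ x y, f x ^ a * g y ^ b ≤ h (a * x + b * y)) :
    (∫⁻ x, f x) ^ a * (∫⁻ x, g x) ^ b ≤ ∫⁻ x, h x := by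
  have hf1' : ∀ x, f x ≤ 1 := fun x => hf1 ▸ le_iSup f x
  have hg1' : ∀ x, g x ≤ 1 := fun x => hg1 ▸ le_iSup g x
  refine (ennreal_amgm ha hb hab _ _).trans ?_
  have hmin : ∫⁻ x, min (h x) 1 ≤ ∫⁻ x, h x := lintegral_mono fun x => min_le_left _ _
  refine le_trans ?_ hmin
  rw [layer_enn hf hf1', layer_enn hg hg1', layer_enn (hh.min measurable_const) (fun x => min_le_right _ _)]
  have anti : ∀ u : ℝ → ℝ≥0∞, Measurable fun t : ℝ => volume {x | ENNReal.ofReal t < u x} := by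
    intro u
    apply Antitone.measurable
    intro s t hst
    exact measure_mono fun x hx => lt_of_le_of_lt (ENNReal.ofReal_le_ofReal hst) hx
  rw [← lintegral_const_mul _ (anti f), ← lintegral_const_mul _ (anti g),
    ← lintegral_add_left ((anti f).const_mul _)]
  refine lintegral_mono fun t => ?_
  by_cases ht : ENNReal.ofReal t < 1
  · obtain ⟨x0, hx0⟩ := lt_iSup_iff.1 (hf1 ▸ ht)
    obtain ⟨y0, hy0⟩ := lt_iSup_iff.1 (hg1 ▸ ht)
    refine bm_weight (measurableSet_lt measurable_const hf) (measurableSet_lt measurable_const hg)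
      ⟨x0, hx0⟩ ⟨y0, hy0⟩ ha hb ?_
    intro x hx y hy
    refine lt_min (lt_of_lt_of_le ?_ (H x y)) ht
    calc ENNReal.ofReal t = ENNReal.ofReal t ^ a * ENNReal.ofReal t ^ b := by
          rw [← ENNReal.rpow_add_of_nonneg _ _ ha.le hb.le, hab, ENNReal.rpow_one]
      _ < _ := ENNReal.mul_lt_mul (ENNReal.rpow_lt_rpow hx ha) (ENNReal.rpow_lt_rpow hy hb)
  · have e1 : {x | ENNReal.ofReal t < f x} = ∅ := by
      ext x; simpa using (hf1' x).trans (not_lt.1 ht)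
    have e2 : {x | ENNReal.ofReal t < g x} = ∅ := by
      ext x; simpa using (hg1' x).trans (not_lt.1 ht)
    simp [e1, e2]

lemma pl_bdd {f g h : ℝ → ℝ≥0∞} (hf : Measurable f) (hg : Measurable g) (hh : Measurable h)
    {a b : ℝ} (ha : 0 < a) (hb : 0 < b) (hab : a + b = 1)
    (hf1 : ⨆ x, f x ≠ ∞) (hg1 : ⨆ x, g x ≠ ∞) 
    (H : ∀ x y, f x ^ a * g y ^ b ≤ h (a * x + b * y)) :
    (∫⁻ x, f x) ^ a * (∫⁻ x, g x) ^ b ≤ ∫⁻ x, h x := by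
  by_cases hf0 : ⨆ x, f x = 0
  · have : f = 0 := by ext x; simpa using (ENNReal.iSup_eq_zero.1 hf0 x)
    simp [this, ha]
  by_cases hg0 : ⨆ x, g x = 0
  · have : g = 0 := by ext x; simpa using (ENNReal.iSup_eq_zero.1 hg0 x)
    simp [this, hb]
  set A := ⨆ x, f x with hA
  set B := ⨆ x, g x with hB
  have hAB0 : A ^ a * B ^ b ≠ 0 := by
    simp [hf0, hg0, hf1, hg1]
  have hABt : A ^ a * B ^ b ≠ ∞ := 
    ENNReal.mul_ne_top (ENNReal.rpow_ne_top_of_nonneg ha.le hf1) (ENNReal.rpow_ne_top_of_nonneg hb.le hg1)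
  have e : ∀ x y : ℝ≥0∞, (A⁻¹ * x) ^ a * (B⁻¹ * y) ^ b = (A ^ a * B ^ b)⁻¹ * (x ^ a * y ^ b) := by
    intro x y
    rw [ENNReal.mul_rpow_of_nonneg _ _ ha.le, ENNReal.mul_rpow_of_nonneg _ _ hb.le, ENNReal.inv_rpow,
      ENNReal.inv_rpow, ENNReal.mul_inv]
    · ring
    · right; exact (ENNReal.rpow_ne_top_of_nonneg hb.le hg1)
    · left; exact (ENNReal.rpow_ne_top_of_nonneg ha.le hf1)
  have := pl_norm (f := fun x => A⁻¹ * f x) (g := fun x => B⁻¹ * g x) 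
    (h := fun x => (A ^ a * B ^ b)⁻¹ * h x) (hf.const_mul _) (hg.const_mul _) (hh.const_mul _) ha hb hab
    (by rw [← ENNReal.mul_iSup, ← hA, ENNReal.inv_mul_cancel hf0 hf1])
    (by rw [← ENNReal.mul_iSup, ← hB, ENNReal.inv_mul_cancel hg0 hg1])
    (by intro x y; simp only [e]; gcongr; exact H x y)
  rw [lintegral_const_mul _ hf, lintegral_const_mul _ hg, lintegral_const_mul _ hh, e] at this
  have h2 := mul_le_mul_right this (A ^ a * B ^ b)
  rwa [← mul_assoc, ENNReal.mul_inv_cancel hAB0 hABt, one_mul, ← mul_assoc,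
    ENNReal.mul_inv_cancel hAB0 hABt, one_mul] at h2

lemma pl_one {f g h : ℝ → ℝ≥0∞} (hf : Measurable f) (hg : Measurable g) (hh : Measurable h)
    {a b : ℝ} (ha : 0 < a) (hb : 0 < b) (hab : a + b = 1)
    (H : ∀ x y, f x ^ a * g y ^ b ≤ h (a * x + b * y)) :
    (∫⁻ x, f x) ^ a * (∫⁻ x, g x) ^ b ≤ ∫⁻ x, h x := by
  have trunc : ∀ u : ℝ → ℝ≥0∞, Measurable u → ∀ r, r < ∫⁻ x, u x →
      ∃ k : ℕ, r < ∫⁻ x, min (u x) k := by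
    intro u hu r hr
    have : ∫⁻ x, u x = ⨆ k : ℕ, ∫⁻ x, min (u x) k := by
      rw [← lintegral_iSup (fun k => hu.min measurable_const)]
      · congr 1; ext x
        rw [← inf_iSup_eq, ENNReal.iSup_natCast, inf_top_eq]
      · intro i j hij x
        exact min_le_min_left _ (by exact_mod_cast hij)
    rw [this] at hr
    exact lt_iSup_iff.1 hr
  refine ENNReal.mul_le_of_forall_lt fun r hr s hs => ?_
  have hr' : r ^ (1 / a) < ∫⁻ x, f x := by
    rw [← ENNReal.rpow_lt_rpow_iff ha, ← ENNReal.rpow_mul, one_div_mul_cancel ha.ne', ENNReal.rpow_one]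
    exact hr
  have hs' : s ^ (1 / b) < ∫⁻ x, g x := by
    rw [← ENNReal.rpow_lt_rpow_iff hb, ← ENNReal.rpow_mul, one_div_mul_cancel hb.ne', ENNReal.rpow_one]
    exact hs
  obtain ⟨k, hk⟩ := trunc f hf _ hr'
  obtain ⟨l, hl⟩ := trunc g hg _ hs'
  rw [← ENNReal.rpow_lt_rpow_iff ha, ← ENNReal.rpow_mul, one_div_mul_cancel ha.ne',
    ENNReal.rpow_one] at hk
  rw [← ENNReal.rpow_lt_rpow_iff hb, ← ENNReal.rpow_mul, one_div_mul_cancel hb.ne',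
    ENNReal.rpow_one] at hl
  refine (mul_le_mul' hk.le hl.le).trans ?_
  refine pl_bdd (hf.min measurable_const) (hg.min measurable_const) hh ha hb hab ?_ ?_ ?_
  · exact ne_top_of_le_ne_top (ENNReal.natCast_ne_top k) (iSup_le fun x => min_le_right _ _)
  · exact ne_top_of_le_ne_top (ENNReal.natCast_ne_top l) (iSup_le fun x => min_le_right _ _)
  · intro x y
    refine le_trans ?_ (H x y)
    gcongr
    · exact min_le_left _ _
    · exact min_le_left _ _

lemma pl_pi (n : ℕ) {f g h : (Fin n → ℝ) → ℝ≥0∞} (hf : Measurable f) (hg : Measurable g) (hh : Measurable h)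
    {a b : ℝ} (ha : 0 < a) (hb : 0 < b) (hab : a + b = 1)
    (H : ∀ x y, f x ^ a * g y ^ b ≤ h (a • x + b • y)) :
    (∫⁻ x, f x) ^ a * (∫⁻ x, g x) ^ b ≤ ∫⁻ x, h x := by
  induction n with
  | zero =>
    have e : ∀ u : (Fin 0 → ℝ) → ℝ≥0∞, ∫⁻ x, u x = u 0 := by
      intro u
      rw [volume_pi, Measure.pi_of_empty _ 0, lintegral_dirac]
    rw [e, e, e]
    simpa using H 0 0
  | succ n ih =>
    have e : ∀ u : (Fin (n+1) → ℝ) → ℝ≥0∞, Measurable u → 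
        ∫⁻ x, u x = ∫⁻ s : ℝ, ∫⁻ y : Fin n → ℝ, u (Fin.cons s y) := by
      intro u hu
      have mp := (volume_preserving_piFinSuccAbove (fun _ : Fin (n + 1) => ℝ) 0).symm
      rw [← mp.lintegral_comp hu]
      have : (volume : Measure (ℝ × (Fin n → ℝ))) = (volume : Measure ℝ).prod volume := rfl
      rw [this, lintegral_prod]
      · simp [MeasurableEquiv.piFinSuccAbove, Fin.insertNthEquiv]
      · exact (hu.comp (MeasurableEquiv.measurable _)).aemeasurable
    have m : ∀ u : (Fin (n+1) → ℝ) → ℝ≥0∞, Measurable u → 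
        Measurable fun p : ℝ × (Fin n → ℝ) => u (Fin.cons p.1 p.2) := by
      intro u hu
      have := hu.comp (MeasurableEquiv.piFinSuccAbove (fun _ : Fin (n + 1) => ℝ) 0).symm.measurable
      simpa [MeasurableEquiv.piFinSuccAbove, Fin.insertNthEquiv, Function.comp_def] using this
    rw [e f hf, e g hg, e h hh]
    refine pl_one (m f hf).lintegral_prod_right' (m g hg).lintegral_prod_right' (m h hh).lintegral_prod_right' ha hb hab ?_
    intro s t
    refine ih ((m f hf).comp (by fun_prop)) ((m g hg).comp (by fun_prop)) ((m h hh).comp (by fun_prop)) ?_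
    intro x y
    convert H (Fin.cons s x) (Fin.cons t y) using 2
    ext i
    refine Fin.cases ?_ (fun j => ?_) i <;> simp

lemma pl_euc (n : ℕ) {f g h : EuclideanSpace ℝ (Fin n) → ℝ≥0∞} (hf : Measurable f) (hg : Measurable g) (hh : Measurable h)
    {a b : ℝ} (ha : 0 < a) (hb : 0 < b) (hab : a + b = 1)
    (H : ∀ x y, f x ^ a * g y ^ b ≤ h (a • x + b • y)) :
    (∫⁻ x, f x) ^ a * (∫⁻ x, g x) ^ b ≤ ∫⁻ x, h x := by
  have mp := PiLp.volume_preserving_toLp (Fin n)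
  rw [← mp.lintegral_comp hf, ← mp.lintegral_comp hg, ← mp.lintegral_comp hh]
  refine pl_pi n (hf.comp mp.measurable) (hg.comp mp.measurable) (hh.comp mp.measurable) ha hb hab ?_
  intro x y
  exact H (WithLp.toLp 2 x) (WithLp.toLp 2 y)

/-- Second moment of `K` in the direction of the functional `ℓ`. -/
noncomputable def mom {n : ℕ} (ℓ : EuclideanSpace ℝ (Fin n) →L[ℝ] ℝ)
    (K : Set (EuclideanSpace ℝ (Fin n))) : ℝ := ∫ x in K, (ℓ x) ^ 2

lemma mom_integrable {n : ℕ} (ℓ : EuclideanSpace ℝ (Fin n) →L[ℝ] ℝ)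
    {K : Set (EuclideanSpace ℝ (Fin n))} (hK : IsCompact K) :
    IntegrableOn (fun x => (ℓ x) ^ 2) K :=
  (by fun_prop : Continuous fun x => (ℓ x) ^ 2).continuousOn.integrableOn_compact hK

lemma mom_nonneg {n : ℕ} (ℓ : EuclideanSpace ℝ (Fin n) →L[ℝ] ℝ)
    (K : Set (EuclideanSpace ℝ (Fin n))) : 0 ≤ mom ℓ K :=
  integral_nonneg fun _ => sq_nonneg _

lemma mom_pos {n : ℕ} {ℓ : EuclideanSpace ℝ (Fin n) →L[ℝ] ℝ} (hℓ : ℓ ≠ 0)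
    {K : Set (EuclideanSpace ℝ (Fin n))} (hK : IsConvexBodyO K) : 0 < mom ℓ K := by
  refine lt_of_le_of_ne (mom_nonneg ℓ K) fun h0 => hℓ ?_
  have h1 := (setIntegral_eq_zero_iff_of_nonneg_ae
    (Filter.Eventually.of_forall fun x => sq_nonneg (ℓ x)) (mom_integrable ℓ hK.1)).1 h0.symm
  have h2 : (fun x => (ℓ x) ^ 2) =ᵐ[volume.restrict (interior K)] fun _ => 0 :=
    ae_restrict_of_ae_restrict_of_subset interior_subset h1
  have h3 := Measure.eqOn_open_of_ae_eq h2 isOpen_interior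
    (by fun_prop : Continuous fun x => (ℓ x) ^ 2).continuousOn continuousOn_const
  ext x
  obtain ⟨ε, hε, hball⟩ := Metric.mem_nhds_iff.1 (mem_interior_iff_mem_nhds.1 hK.2.2)
  have hx : ∀ᶠ t : ℝ in nhds 0, t • x ∈ interior K := by
    have hc : Filter.Tendsto (fun t : ℝ => t • x) (nhds 0) (nhds ((0 : ℝ) • x)) :=
      (by fun_prop : Continuous fun t : ℝ => t • x).tendsto 0
    rw [zero_smul] at hc
    exact hc (isOpen_interior.mem_nhds hK.2.2)
  have hx' := (hx.filter_mono nhdsWithin_le_nhds).and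
    (self_mem_nhdsWithin : Set.Ioi (0:ℝ) ∈ nhdsWithin 0 (Set.Ioi 0))
  obtain ⟨t, ht, ht0⟩ := hx'.exists
  have := h3 ht
  simp only [map_smul, smul_eq_mul] at this
  have h5 := pow_eq_zero_iff (two_ne_zero) |>.1 this
  rcases mul_eq_zero.1 h5 with h | h
  · exact absurd h (ne_of_gt ht0)
  · simpa using h

lemma ofReal_mom {n : ℕ} (ℓ : EuclideanSpace ℝ (Fin n) →L[ℝ] ℝ)
    {K : Set (EuclideanSpace ℝ (Fin n))} (hK : IsCompact K) (hs : K = -K) :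
    ENNReal.ofReal (mom ℓ K) = 2 * ∫⁻ x in K, ENNReal.ofReal (ℓ x) ^ 2 := by
  unfold mom
  rw [ofReal_integral_eq_lintegral_ofReal (mom_integrable ℓ hK)
    (Filter.Eventually.of_forall fun x => sq_nonneg (ℓ x))]
  have e : ∀ x, ENNReal.ofReal ((ℓ x) ^ 2) =
      ENNReal.ofReal (ℓ x) ^ 2 + ENNReal.ofReal (ℓ (-x)) ^ 2 := by
    intro x
    rw [map_neg]
    rcases le_total 0 (ℓ x) with h | h
    · rw [ENNReal.ofReal_of_nonpos (neg_nonpos.2 h), ENNReal.ofReal_pow h]; simp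
    · rw [ENNReal.ofReal_of_nonpos h, ← ENNReal.ofReal_pow (neg_nonneg.2 h)]; simp
  simp only [e]
  have hm : Measurable fun x : EuclideanSpace ℝ (Fin n) => ENNReal.ofReal (ℓ x) ^ 2 := by fun_prop
  rw [lintegral_add_left hm, two_mul]
  congr 1
  have := (Measure.measurePreserving_neg
    (volume : Measure (EuclideanSpace ℝ (Fin n)))).setLIntegral_comp_preimage hK.measurableSet hm
  rw [← this]
  have hK' : Neg.neg ⁻¹' K = K := by
    conv_rhs => rw [hs]
    rfl
  rw [hK']

lemma mom_pl {n : ℕ} (ℓ : EuclideanSpace ℝ (Fin n) →L[ℝ] ℝ)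
    {A B C : Set (EuclideanSpace ℝ (Fin n))} (hA : IsCompact A) (hB : IsCompact B)
    (hC : IsCompact C) (sA : A = -A) (sB : B = -B) (sC : C = -C) {a b : ℝ} (ha : 0 < a)
    (hb : 0 < b) (hab : a + b = 1) (h : ∀ x ∈ A, ∀ y ∈ B, a • x + b • y ∈ C)
    (mA : mom ℓ A = 1) (mB : mom ℓ B = 1) : 1 ≤ mom ℓ C := by
  have hm : Measurable fun x : EuclideanSpace ℝ (Fin n) => ENNReal.ofReal (ℓ x) ^ 2 := by fun_prop
  have key := pl_euc n (hm.indicator hA.measurableSet) (hm.indicator hB.measurableSet)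
    (hm.indicator hC.measurableSet) ha hb hab (by
      intro x y
      by_cases hx : x ∈ A
      swap
      · simp [hx, ha]
      by_cases hy : y ∈ B
      swap
      · simp [hy, hb]
      rw [Set.indicator_of_mem hx, Set.indicator_of_mem hy, Set.indicator_of_mem (h x hx y hy)]
      by_cases hx0 : ℓ x ≤ 0
      · simp [ENNReal.ofReal_of_nonpos hx0, ha]
      by_cases hy0 : ℓ y ≤ 0
      · simp [ENNReal.ofReal_of_nonpos hy0, hb]
      push Not at hx0 hy0
      have e : ∀ (z : ℝ≥0∞) (c : ℝ), (z ^ 2) ^ c = (z ^ c) ^ 2 := by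
        intro z c
        rw [← ENNReal.rpow_natCast, ← ENNReal.rpow_natCast, ← ENNReal.rpow_mul,
          ← ENNReal.rpow_mul, mul_comm]
      rw [e, e, ← mul_pow]
      gcongr
      refine (ennreal_amgm ha hb hab _ _).trans (le_of_eq ?_)
      rw [← ENNReal.ofReal_mul ha.le, ← ENNReal.ofReal_mul hb.le, ← ENNReal.ofReal_add
        (by positivity) (by positivity)]
      simp)
  rw [lintegral_indicator hA.measurableSet, lintegral_indicator hB.measurableSet,
    lintegral_indicator hC.measurableSet] at key
  have eA := ofReal_mom ℓ hA sA
  have eB := ofReal_mom ℓ hB sB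
  have eC := ofReal_mom ℓ hC sC
  rw [mA, ENNReal.ofReal_one] at eA
  rw [mB, ENNReal.ofReal_one] at eB
  have : (1 : ℝ≥0∞) ≤ ENNReal.ofReal (mom ℓ C) := by
    rw [eC]
    refine le_trans (le_of_eq ?_) (mul_le_mul_right key 2)
    calc (1 : ℝ≥0∞) = 1 ^ a * 1 ^ b := by simp
      _ = (2 * ∫⁻ x in A, ENNReal.ofReal (ℓ x) ^ 2) ^ a *
          (2 * ∫⁻ x in B, ENNReal.ofReal (ℓ x) ^ 2) ^ b := by rw [← eA, ← eB]
      _ = (2 ^ a * 2 ^ b) * ((∫⁻ x in A, ENNReal.ofReal (ℓ x) ^ 2) ^ a *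
          (∫⁻ x in B, ENNReal.ofReal (ℓ x) ^ 2) ^ b) := by
        rw [ENNReal.mul_rpow_of_nonneg _ _ ha.le, ENNReal.mul_rpow_of_nonneg _ _ hb.le]; ring
      _ = _ := by
        rw [← ENNReal.rpow_add_of_nonneg _ _ ha.le hb.le, hab, ENNReal.rpow_one]
  simpa using this

lemma mom_smul {n : ℕ} (ℓ : EuclideanSpace ℝ (Fin n) →L[ℝ] ℝ)
    (K : Set (EuclideanSpace ℝ (Fin n))) {R : ℝ} (hR : 0 < R) :
    mom ℓ (R • K) = R ^ (n + 2) * mom ℓ K := by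
  have := Measure.setIntegral_comp_smul_of_pos volume (fun x => (ℓ x) ^ 2) K hR
  simp only [map_smul, smul_eq_mul, mul_pow, finrank_euclideanSpace, Fintype.card_fin] at this
  rw [integral_const_mul] at this
  unfold mom
  have hn : R ^ n ≠ 0 := by positivity
  rw [eq_inv_mul_iff_mul_eq₀ hn] at this
  rw [← this]; ring

lemma le_supp {n : ℕ} {K : Set (EuclideanSpace ℝ (Fin n))} (hK : IsCompact K)
    {x : EuclideanSpace ℝ (Fin n)} (hx : x ∈ K) (u : EuclideanSpace ℝ (Fin n)) :
    ⟪x, u⟫ ≤ supp K u :=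
  le_csSup (hK.image (by fun_prop)).bddAbove ⟨x, hx, rfl⟩

lemma supp_nonneg {n : ℕ} {K : Set (EuclideanSpace ℝ (Fin n))} (hK : IsConvexBodyO K)
    (u : EuclideanSpace ℝ (Fin n)) : 0 ≤ supp K u := by
  simpa using le_supp hK.1 (interior_subset hK.2.2) u

lemma supp_neg {n : ℕ} {K : Set (EuclideanSpace ℝ (Fin n))} (hs : K = -K)
    (u : EuclideanSpace ℝ (Fin n)) : supp K (-u) = supp K u := by
  unfold supp
  congr 1
  ext r
  constructor
  · rintro ⟨x, hx, rfl⟩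
    rw [hs] at hx
    exact ⟨-x, hx, by simp⟩
  · rintro ⟨x, hx, rfl⟩
    rw [hs] at hx
    exact ⟨-x, hx, by simp⟩

lemma mem_of_supp {n : ℕ} {K : Set (EuclideanSpace ℝ (Fin n))} (hK : IsConvexBodyO K)
    {y : EuclideanSpace ℝ (Fin n)} (h : ∀ u, ‖u‖ = 1 → ⟪y, u⟫ ≤ supp K u) : y ∈ K := by
  by_contra hy
  obtain ⟨f, s, hf, hs⟩ := geometric_hahn_banach_closed_point hK.2.1 hK.1.isClosed hy
  obtain ⟨v, hv⟩ := (InnerProductSpace.toDual ℝ (EuclideanSpace ℝ (Fin n))).surjective f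
  have hfv : ∀ x, f x = ⟪x, v⟫ := by
    intro x; rw [← hv, InnerProductSpace.toDual_apply_apply, real_inner_comm]
  have h0 : (0 : EuclideanSpace ℝ (Fin n)) ∈ K := interior_subset hK.2.2
  have hs0 : 0 < s := by simpa using hf 0 h0
  have hv0 : v ≠ 0 := by
    rintro rfl
    rw [hfv] at hs
    simp at hs
    linarith
  have hnv : 0 < ‖v‖ := norm_pos_iff.2 hv0
  have h1 := h (‖v‖⁻¹ • v) (by rw [norm_smul]; simp [hnv.ne'])
  have h2 : supp K (‖v‖⁻¹ • v) ≤ ‖v‖⁻¹ * s := by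
    refine csSup_le (Set.Nonempty.image _ ⟨0, h0⟩) ?_
    rintro _ ⟨x, hx, rfl⟩
    have := (hf x hx).le
    rw [hfv] at this
    simp only [inner_smul_right]
    gcongr
  rw [inner_smul_right] at h1
  have h3 := le_of_mul_le_mul_left (h1.trans h2) (inv_pos.2 hnv)
  rw [hfv] at hs
  linarith

lemma lp_symm {n : ℕ} {p : ℝ} (hp : 1 ≤ p) {K₀ K₁ M : Set (EuclideanSpace ℝ (Fin n))}
    (hM : IsConvexBodyO M) (hK₀symm : K₀ = -K₀) (hK₁symm : K₁ = -K₁)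
    (hMsupp : ∀ u : EuclideanSpace ℝ (Fin n), ‖u‖ = 1 →
      supp M u ^ p = supp K₀ u ^ p + supp K₁ u ^ p) : M = -M := by
  have key : ∀ y ∈ M, -y ∈ M := by
    intro y hy
    refine mem_of_supp hM fun u hu => ?_
    have h1 := hMsupp u hu
    have h2 := hMsupp (-u) (by simpa using hu)
    rw [supp_neg hK₀symm, supp_neg hK₁symm, ← h1] at h2
    rw [← (Real.rpow_left_inj (supp_nonneg hM _) (supp_nonneg hM _) (by linarith)).1 h2]
    simpa using le_supp hM.1 hy (-u)
  ext y
  exact ⟨fun hy => key y hy, fun hy => by simpa using key _ hy⟩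

lemma smul_symm {n : ℕ} {K : Set (EuclideanSpace ℝ (Fin n))} (hs : K = -K) (c : ℝ) :
    c • K = -(c • K) := by
  rw [← Set.smul_set_neg, ← hs]

lemma mom_lp {n : ℕ} {p : ℝ} (hp : 1 ≤ p) {K₀ K₁ M : Set (EuclideanSpace ℝ (Fin n))}
    (hK₀ : IsConvexBodyO K₀) (hK₁ : IsConvexBodyO K₁)
    (hM : IsConvexBodyO M) (hK₀symm : K₀ = -K₀) (hK₁symm : K₁ = -K₁)
    (hMsupp : ∀ u : EuclideanSpace ℝ (Fin n), ‖u‖ = 1 →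
      supp M u ^ p = supp K₀ u ^ p + supp K₁ u ^ p)
    {ℓ : EuclideanSpace ℝ (Fin n) →L[ℝ] ℝ} (hℓ : ℓ ≠ 0) :
    mom ℓ K₀ ^ (p / (n + 2)) + mom ℓ K₁ ^ (p / (n + 2)) ≤ mom ℓ M ^ (p / (n + 2)) := by
  have hMsymm := lp_symm hp hM hK₀symm hK₁symm hMsupp
  have hp0 : 0 < p := by linarith
  have m0 := mom_pos hℓ hK₀
  have m1 := mom_pos hℓ hK₁
  have hn2 : (0 : ℝ) < n + 2 := by positivity
  set a := mom ℓ K₀ ^ (1 / (n + 2 : ℝ)) with ha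
  set b := mom ℓ K₁ ^ (1 / (n + 2 : ℝ)) with hb
  have a0 : 0 < a := Real.rpow_pos_of_pos m0 _
  have b0 : 0 < b := Real.rpow_pos_of_pos m1 _
  have ap : mom ℓ K₀ ^ (p / (n + 2)) = a ^ p := by
    rw [ha, ← Real.rpow_mul m0.le]; congr 1; ring
  have bp : mom ℓ K₁ ^ (p / (n + 2)) = b ^ p := by
    rw [hb, ← Real.rpow_mul m1.le]; congr 1; ring
  have an : a ^ (n + 2) = mom ℓ K₀ := by
    rw [ha, ← Real.rpow_natCast, ← Real.rpow_mul m0.le]; push_cast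
    rw [one_div_mul_cancel hn2.ne', Real.rpow_one]
  have bn : b ^ (n + 2) = mom ℓ K₁ := by
    rw [hb, ← Real.rpow_natCast, ← Real.rpow_mul m1.le]; push_cast
    rw [one_div_mul_cancel hn2.ne', Real.rpow_one]
  rw [ap, bp]
  have app : 0 < a ^ p := Real.rpow_pos_of_pos a0 _
  have bpp : 0 < b ^ p := Real.rpow_pos_of_pos b0 _
  set S := (a ^ p + b ^ p) ^ (1 / p) with hS
  have S0 : 0 < S := by positivity
  have Sp : S ^ p = a ^ p + b ^ p := by
    rw [hS, ← Real.rpow_mul (by positivity), one_div_mul_cancel hp0.ne', Real.rpow_one]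
  have hSp0 : 0 < S ^ p := by positivity
  have hw : a ^ p / S ^ p + b ^ p / S ^ p = 1 := by
    rw [← add_div, ← Sp, div_self hSp0.ne']
  have main := mom_pl ℓ (A := a⁻¹ • K₀) (B := b⁻¹ • K₁) (C := S⁻¹ • M) (hK₀.1.smul _) (hK₁.1.smul _)
    (hM.1.smul _) (smul_symm hK₀symm _) (smul_symm hK₁symm _) (smul_symm hMsymm _)
    (a := a ^ p / S ^ p) (b := b ^ p / S ^ p) (by positivity) (by positivity) hw (by
      rintro _ ⟨x, hx, rfl⟩ _ ⟨y, hy, rfl⟩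
      rw [Set.mem_inv_smul_set_iff₀ S0.ne']
      refine mem_of_supp hM fun u hu => ?_
      set r := supp K₀ u with hr
      set s := supp K₁ u with hs
      have r0 : 0 ≤ r := supp_nonneg hK₀ u
      have s0 : 0 ≤ s := supp_nonneg hK₁ u
      have hxr : ⟪x, u⟫ ≤ r := le_supp hK₀.1 hx u
      have hys : ⟪y, u⟫ ≤ s := le_supp hK₁.1 hy u
      have step : ⟪S • ((a ^ p / S ^ p) • (fun x => a⁻¹ • x) x + (b ^ p / S ^ p) • (fun x => b⁻¹ • x) y), u⟫
          ≤ S * ((a ^ p / S ^ p) * (a⁻¹ * r) + (b ^ p / S ^ p) * (b⁻¹ * s)) := by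
        simp only [inner_smul_left, inner_add_left, conj_trivial]
        gcongr
      refine step.trans ?_
      rw [← Real.rpow_le_rpow_iff (by positivity) (supp_nonneg hM u) hp0, hMsupp u hu,
        Real.mul_rpow S0.le (by positivity)]
      have conv := (convexOn_rpow hp).2 (show a⁻¹ * r ∈ Set.Ici 0 from by simp; positivity)
        (show b⁻¹ * s ∈ Set.Ici 0 from by simp; positivity)
        (show 0 ≤ a ^ p / S ^ p by positivity) (show 0 ≤ b ^ p / S ^ p by positivity) hw
      simp only [smul_eq_mul] at conv
      refine (mul_le_mul_of_nonneg_left conv hSp0.le).trans (le_of_eq ?_)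
      rw [Real.mul_rpow (by positivity) r0, Real.mul_rpow (by positivity) s0,
        Real.inv_rpow a0.le, Real.inv_rpow b0.le]
      field_simp
      rfl)
    (by rw [mom_smul _ _ (by positivity), ← an, ← mul_pow, inv_mul_cancel₀ a0.ne', one_pow])
    (by rw [mom_smul _ _ (by positivity), ← bn, ← mul_pow, inv_mul_cancel₀ b0.ne', one_pow])
  rw [mom_smul _ _ (by positivity), inv_pow, ← div_eq_inv_mul, one_le_div (by positivity)] at main
  rw [← Sp]
  calc S ^ p = (S ^ (n + 2)) ^ (p / (n + 2)) := by
        rw [← Real.rpow_natCast, ← Real.rpow_mul S0.le]; congr 1; push_cast; field_simp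
    _ ≤ _ := by gcongr

/-- The `i`-th coordinate of the linear map `T`, as a continuous functional. -/
noncomputable def coordFun {n : ℕ} (T : EuclideanSpace ℝ (Fin n) →ₗ[ℝ] EuclideanSpace ℝ (Fin n))
    (i : Fin n) : EuclideanSpace ℝ (Fin n) →L[ℝ] ℝ :=
  (EuclideanSpace.proj i : EuclideanSpace ℝ (Fin n) →L[ℝ] ℝ).comp T.toContinuousLinearMap

lemma coordFun_apply {n : ℕ} (T : EuclideanSpace ℝ (Fin n) →ₗ[ℝ] EuclideanSpace ℝ (Fin n))
    (i : Fin n) (x : EuclideanSpace ℝ (Fin n)) : coordFun T i x = (T x) i := rfl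

lemma bij_of_det {n : ℕ} {T : EuclideanSpace ℝ (Fin n) →ₗ[ℝ] EuclideanSpace ℝ (Fin n)}
    (hT : LinearMap.det T = 1) : Function.Bijective T := by
  have h : IsUnit T := (LinearMap.isUnit_iff_isUnit_det T).2 (by rw [hT]; exact isUnit_one)
  exact (Module.End.isUnit_iff T).1 h

lemma coordFun_ne_zero {n : ℕ} {T : EuclideanSpace ℝ (Fin n) →ₗ[ℝ] EuclideanSpace ℝ (Fin n)}
    (hT : LinearMap.det T = 1) (i : Fin n) : coordFun T i ≠ 0 := by
  intro h
  obtain ⟨x, hx⟩ := (bij_of_det hT).2 (EuclideanSpace.single i (1 : ℝ))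
  have : coordFun T i x = 0 := by rw [h]; rfl
  rw [coordFun_apply, hx] at this
  simp at this

lemma centroid_symm {n : ℕ} {K : Set (EuclideanSpace ℝ (Fin n))} (hs : K = -K) :
    centroid K = 0 := by
  unfold centroid
  have h1 := (Measure.measurePreserving_neg
    (volume : Measure (EuclideanSpace ℝ (Fin n)))).setIntegral_preimage_emb
    (MeasurableEquiv.neg _).measurableEmbedding (fun x => x) K
  have hK' : Neg.neg ⁻¹' K = K := by
    conv_rhs => rw [hs]
    rfl
  rw [hK', integral_neg] at h1
  have h2 : ∫ x in K, x = 0 := by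
    have h3 : (2 : ℝ) • ∫ x in K, x = 0 := by
      rw [two_smul]
      nth_rewrite 1 [← h1]
      exact neg_add_cancel _
    simpa using h3
  rw [h2, smul_zero]

lemma inertia_image {n : ℕ} {K : Set (EuclideanSpace ℝ (Fin n))} (hK : IsCompact K) (hs : K = -K)
    {T : EuclideanSpace ℝ (Fin n) →ₗ[ℝ] EuclideanSpace ℝ (Fin n)} (hT : LinearMap.det T = 1) :
    inertia (T '' K) = ∑ i, mom (coordFun T i) K := by
  have hs' : T '' K = -(T '' K) := by
    rw [← Set.image_neg_of_apply_neg_eq_neg (f := T) (fun x _ => map_neg T x), ← hs]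
  unfold inertia
  rw [centroid_symm hs']
  simp only [sub_zero]
  have := integral_image_eq_integral_abs_det_fderiv_smul volume hK.measurableSet
    (f := T) (f' := fun _ => T.toContinuousLinearMap)
    (fun x _ => T.toContinuousLinearMap.hasFDerivWithinAt) (bij_of_det hT).1.injOn
    (fun x => ‖x‖ ^ 2)
  rw [this]
  have hdet : T.toContinuousLinearMap.det = 1 := by
    simpa [ContinuousLinearMap.det] using hT
  simp only [hdet, abs_one, one_smul, EuclideanSpace.real_norm_sq_eq]
  rw [integral_finsetSum]
  · rfl
  · intro i _
    exact mom_integrable (coordFun T i) hK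

lemma geom_super {n : ℕ} (hn : 1 ≤ n) (a b : Fin n → ℝ) (ha : ∀ i, 0 < a i) (hb : ∀ i, 0 < b i) :
    ∏ i, a i ^ (1 / (n : ℝ)) + ∏ i, b i ^ (1 / (n : ℝ)) ≤ ∏ i, (a i + b i) ^ (1 / (n : ℝ)) := by
  have hn0 : (0 : ℝ) < n := by exact_mod_cast hn
  have hw : ∑ _i : Fin n, (1 / (n : ℝ)) = 1 := by simp [hn0.ne']
  have hab : ∀ i, 0 < a i + b i := fun i => add_pos (ha i) (hb i)
  have e1 := Real.geom_mean_le_arith_mean_weighted Finset.univ (fun _ => 1 / (n : ℝ))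
    (fun i => a i / (a i + b i)) (fun _ _ => by positivity) hw
    (fun i _ => (div_pos (ha i) (hab i)).le)
  have e2 := Real.geom_mean_le_arith_mean_weighted Finset.univ (fun _ => 1 / (n : ℝ))
    (fun i => b i / (a i + b i)) (fun _ _ => by positivity) hw
    (fun i _ => (div_pos (hb i) (hab i)).le)
  have e3 := add_le_add e1 e2
  rw [← Finset.sum_add_distrib] at e3
  have e4 : ∀ i, 1 / (n : ℝ) * (a i / (a i + b i)) + 1 / (n : ℝ) * (b i / (a i + b i)) = 1 / (n : ℝ) := by
    intro i
    rw [← mul_add, ← add_div, div_self (hab i).ne', mul_one]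
  simp only [e4, hw] at e3
  simp only [fun i => Real.div_rpow (ha i).le (hab i).le, fun i => Real.div_rpow (hb i).le (hab i).le,
    Finset.prod_div_distrib] at e3
  rw [← add_div, div_le_one] at e3
  · exact e3
  · exact Finset.prod_pos fun i _ => Real.rpow_pos_of_pos (hab i) _

/-- The infimum of the moments of inertia of the `SL(n)`-images of `K`. -/
noncomputable def infI {n : ℕ} (K : Set (EuclideanSpace ℝ (Fin n))) : ℝ :=
  sInf {r : ℝ | ∃ T : EuclideanSpace ℝ (Fin n) →ₗ[ℝ] EuclideanSpace ℝ (Fin n),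
      LinearMap.det T = 1 ∧ r = inertia (T '' K)}

lemma inertia_nonneg {n : ℕ} (K : Set (EuclideanSpace ℝ (Fin n))) : 0 ≤ inertia K :=
  integral_nonneg fun _ => sq_nonneg _

lemma infI_nonneg {n : ℕ} (K : Set (EuclideanSpace ℝ (Fin n))) : 0 ≤ infI K := by
  refine Real.sInf_nonneg ?_
  rintro _ ⟨T, _, rfl⟩
  exact inertia_nonneg _

lemma infI_le {n : ℕ} (K : Set (EuclideanSpace ℝ (Fin n)))
    {T : EuclideanSpace ℝ (Fin n) →ₗ[ℝ] EuclideanSpace ℝ (Fin n)} (hT : LinearMap.det T = 1) :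
    infI K ≤ inertia (T '' K) := by
  refine csInf_le ⟨0, ?_⟩ ⟨T, hT, rfl⟩
  rintro _ ⟨T, _, rfl⟩
  exact inertia_nonneg _

lemma functional_eq {n : ℕ} (hn : 1 ≤ n) (p : ℝ) {K : Set (EuclideanSpace ℝ (Fin n))}
    (hK : IsConvexBodyO K) :
    (volume K).toReal ^ (p / n) * isotropicConst K ^ (2 * p / (n + 2)) =
      (infI K / n) ^ (p / (n + 2)) := by
  have hn0 : (0 : ℝ) < n := by exact_mod_cast hn
  have hV : 0 < (volume K).toReal := by
    refine ENNReal.toReal_pos ?_ hK.1.measure_lt_top.ne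
    exact (Measure.measure_pos_of_nonempty_interior volume ⟨0, hK.2.2⟩).ne'
  set V := (volume K).toReal with hVdef
  set c := V ^ (((n : ℝ) + 2) / n) with hc
  have hc0 : 0 < c := Real.rpow_pos_of_pos hV _
  have hset : {r : ℝ | ∃ T : EuclideanSpace ℝ (Fin n) →ₗ[ℝ] EuclideanSpace ℝ (Fin n),
      LinearMap.det T = 1 ∧ r = inertia (T '' K) / c} =
      c⁻¹ • {r : ℝ | ∃ T : EuclideanSpace ℝ (Fin n) →ₗ[ℝ] EuclideanSpace ℝ (Fin n),
      LinearMap.det T = 1 ∧ r = inertia (T '' K)} := by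
    ext r
    constructor
    · rintro ⟨T, hT, rfl⟩
      exact ⟨_, ⟨T, hT, rfl⟩, by simp [div_eq_inv_mul]⟩
    · rintro ⟨_, ⟨T, hT, rfl⟩, rfl⟩
      exact ⟨T, hT, by simp [div_eq_inv_mul]⟩
  have hJ := infI_nonneg K
  have e : isotropicConst K = Real.sqrt ((infI K / n) * c⁻¹) := by
    unfold isotropicConst
    rw [← hVdef, ← hc, hset, Real.sInf_smul_of_nonneg (by positivity)]
    congr 1
    simp only [smul_eq_mul, infI]
    ring
  rw [e, Real.sqrt_eq_rpow, ← Real.rpow_mul (by positivity),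
    show 1 / 2 * (2 * p / ((n : ℝ) + 2)) = p / (n + 2) by ring,
    Real.mul_rpow (by positivity) (by positivity), Real.inv_rpow hc0.le, hc, ← Real.rpow_mul hV.le,
    show ((n : ℝ) + 2) / n * (p / (n + 2)) = p / n by field_simp]
  field_simp

lemma diag_bound {n : ℕ} (hn : 1 ≤ n) {K : Set (EuclideanSpace ℝ (Fin n))}
    (hK : IsConvexBodyO K) (hs : K = -K)
    {T : EuclideanSpace ℝ (Fin n) →ₗ[ℝ] EuclideanSpace ℝ (Fin n)} (hT : LinearMap.det T = 1) :
    infI K / n ≤ ∏ i, mom (coordFun T i) K ^ (1 / (n : ℝ)) := by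
  have hn0 : (0 : ℝ) < n := by exact_mod_cast hn
  have hF : ∀ i, 0 < mom (coordFun T i) K := fun i => mom_pos (coordFun_ne_zero hT i) hK
  set G := ∏ i, mom (coordFun T i) K ^ (1 / (n : ℝ)) with hG
  have hG0 : 0 < G := Finset.prod_pos fun i _ => Real.rpow_pos_of_pos (hF i) _
  have hGn : G ^ n = ∏ i, mom (coordFun T i) K := by
    rw [hG, ← Finset.prod_pow]
    refine Finset.prod_congr rfl fun i _ => ?_
    rw [← Real.rpow_natCast, ← Real.rpow_mul (hF i).le, one_div_mul_cancel hn0.ne', Real.rpow_one]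
  set c : Fin n → ℝ := fun i => Real.sqrt (G / mom (coordFun T i) K) with hc
  have hprod : ∏ i, c i = 1 := by
    have h1 : (∏ i, c i) ^ 2 = 1 := by
      rw [← Finset.prod_pow]
      simp only [hc, fun i => Real.sq_sqrt (div_pos hG0 (hF i)).le]
      rw [Finset.prod_div_distrib, Finset.prod_const, Finset.card_univ, Fintype.card_fin, hGn,
        div_self (Finset.prod_pos fun i _ => hF i).ne']
    have h2 : 0 ≤ ∏ i, c i := Finset.prod_nonneg fun i _ => Real.sqrt_nonneg _
    nlinarith
  set D : EuclideanSpace ℝ (Fin n) →ₗ[ℝ] EuclideanSpace ℝ (Fin n) :=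
    Matrix.toEuclideanLin (Matrix.diagonal c) with hD
  have hDdet : LinearMap.det D = 1 := by
    rw [hD, Matrix.toEuclideanLin_eq_toLin_orthonormal, LinearMap.det_toLin, Matrix.det_diagonal,
      hprod]
  have hDT : LinearMap.det (D ∘ₗ T) = 1 := by rw [LinearMap.det_comp, hDdet, hT, one_mul]
  have h1 := infI_le K hDT
  rw [inertia_image hK.1 hs hDT] at h1
  have h2 : ∀ i, mom (coordFun (D ∘ₗ T) i) K = G := by
    intro i
    have h3 : ∀ x, coordFun (D ∘ₗ T) i x ^ 2 = c i ^ 2 * coordFun T i x ^ 2 := by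
      intro x
      rw [coordFun_apply, coordFun_apply, ← mul_pow]
      congr 1
      simp [hD, Matrix.toLpLin_apply, Matrix.mulVec_diagonal]
    unfold mom
    simp only [h3]
    rw [integral_const_mul]
    change c i ^ 2 * mom (coordFun T i) K = G
    rw [hc]
    simp only []
    rw [Real.sq_sqrt (div_pos hG0 (hF i)).le, div_mul_cancel₀ _ (hF i).ne']
  simp only [h2, Finset.sum_const, Finset.card_univ, Fintype.card_fin, nsmul_eq_mul] at h1
  rw [div_le_iff₀ hn0]
  linarith

/-- Corollary 4.1, `L_p` inequality for isotropic constants.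
For `1 ≤ p < ∞`, origin-symmetric `K₀, K₁ ∈ 𝒦ⁿₒ`, and `M = K₀ +_p K₁` (the convex body
with origin in its interior whose support function satisfies `h_M^p = h_{K₀}^p + h_{K₁}^p`
on the unit sphere),
`V_n(M)^{p/n} L_M^{2p/(n+2)} ≥ V_n(K₀)^{p/n} L_{K₀}^{2p/(n+2)} + V_n(K₁)^{p/n} L_{K₁}^{2p/(n+2)}`. -/
theorem isotropicConst_lp_inequality {n : ℕ} (hn : 1 ≤ n) (p : ℝ) (hp : 1 ≤ p)
    (K₀ K₁ M : Set (EuclideanSpace ℝ (Fin n)))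
    (hK₀ : IsConvexBodyO K₀) (hK₁ : IsConvexBodyO K₁) (hM : IsConvexBodyO M)
    (hK₀symm : K₀ = -K₀) (hK₁symm : K₁ = -K₁)
    (hMsupp : ∀ u : EuclideanSpace ℝ (Fin n), ‖u‖ = 1 →
      supp M u ^ p = supp K₀ u ^ p + supp K₁ u ^ p) :
    (volume K₀).toReal ^ (p / n) * isotropicConst K₀ ^ (2 * p / (n + 2)) +
        (volume K₁).toReal ^ (p / n) * isotropicConst K₁ ^ (2 * p / (n + 2)) ≤
      (volume M).toReal ^ (p / n) * isotropicConst M ^ (2 * p / (n + 2)) := by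
  have hn0 : (0 : ℝ) < n := by exact_mod_cast hn
  rw [functional_eq hn p hK₀, functional_eq hn p hK₁, functional_eq hn p hM]
  have hMsymm := lp_symm hp hM hK₀symm hK₁symm hMsupp
  set β : ℝ := p / (n + 2) with hβ
  have hβ0 : 0 < β := by positivity
  have swap : ∀ (K : Set (EuclideanSpace ℝ (Fin n))) (T), 
      ∏ i, (mom (coordFun T i) K ^ β) ^ (1 / (n : ℝ)) =
        (∏ i, mom (coordFun T i) K ^ (1 / (n : ℝ))) ^ β := by
    intro K T
    rw [← Real.finsetProd_rpow _ _ fun i _ => Real.rpow_nonneg (mom_nonneg _ _) _]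
    refine Finset.prod_congr rfl fun i _ => ?_
    rw [← Real.rpow_mul (mom_nonneg _ _), ← Real.rpow_mul (mom_nonneg _ _), mul_comm]
  have step : ∀ T : EuclideanSpace ℝ (Fin n) →ₗ[ℝ] EuclideanSpace ℝ (Fin n),
      LinearMap.det T = 1 →
      (infI K₀ / n) ^ β + (infI K₁ / n) ^ β ≤ (inertia (T '' M) / n) ^ β := by
    intro T hT
    have pos : ∀ {K : Set (EuclideanSpace ℝ (Fin n))}, IsConvexBodyO K → ∀ i,
        0 < mom (coordFun T i) K := fun hK i => mom_pos (coordFun_ne_zero hT i) hK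
    calc (infI K₀ / n) ^ β + (infI K₁ / n) ^ β
        ≤ (∏ i, mom (coordFun T i) K₀ ^ (1 / (n : ℝ))) ^ β +
          (∏ i, mom (coordFun T i) K₁ ^ (1 / (n : ℝ))) ^ β := by
          refine add_le_add ?_ ?_
          · exact Real.rpow_le_rpow (div_nonneg (infI_nonneg _) hn0.le)
              (diag_bound hn hK₀ hK₀symm hT) hβ0.le
          · exact Real.rpow_le_rpow (div_nonneg (infI_nonneg _) hn0.le)
              (diag_bound hn hK₁ hK₁symm hT) hβ0.le
      _ = ∏ i, (mom (coordFun T i) K₀ ^ β) ^ (1 / (n : ℝ)) +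
          ∏ i, (mom (coordFun T i) K₁ ^ β) ^ (1 / (n : ℝ)) := by rw [swap, swap]
      _ ≤ ∏ i, (mom (coordFun T i) K₀ ^ β + mom (coordFun T i) K₁ ^ β) ^ (1 / (n : ℝ)) :=
          geom_super hn _ _ (fun i => Real.rpow_pos_of_pos (pos hK₀ i) _)
            (fun i => Real.rpow_pos_of_pos (pos hK₁ i) _)
      _ ≤ ∏ i, (mom (coordFun T i) M ^ β) ^ (1 / (n : ℝ)) := by
          refine Finset.prod_le_prod (fun i _ => ?_) (fun i _ => ?_)
          · have := mom_nonneg (coordFun T i) K₀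
            have := mom_nonneg (coordFun T i) K₁
            positivity
          · refine Real.rpow_le_rpow ?_ (mom_lp hp hK₀ hK₁ hM hK₀symm hK₁symm hMsupp
              (coordFun_ne_zero hT i)) (by positivity)
            have := mom_nonneg (coordFun T i) K₀
            have := mom_nonneg (coordFun T i) K₁
            positivity
      _ = (∏ i, mom (coordFun T i) M ^ (1 / (n : ℝ))) ^ β := swap _ _
      _ ≤ (inertia (T '' M) / n) ^ β := by
          refine Real.rpow_le_rpow (Finset.prod_nonneg fun i _ =>
            Real.rpow_nonneg (mom_nonneg _ _) _) ?_ hβ0.le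
          have h := Real.geom_mean_le_arith_mean_weighted Finset.univ (fun _ : Fin n => 1 / (n : ℝ))
            (fun i => mom (coordFun T i) M) (fun _ _ => by positivity) (by simp [hn0.ne'])
            (fun i _ => mom_nonneg _ _)
          rw [inertia_image hM.1 hMsymm hT]
          refine h.trans (le_of_eq ?_)
          rw [← Finset.mul_sum]
          ring
  have hX : 0 ≤ (infI K₀ / n) ^ β + (infI K₁ / n) ^ β :=
    add_nonneg (Real.rpow_nonneg (div_nonneg (infI_nonneg _) hn0.le) _)
      (Real.rpow_nonneg (div_nonneg (infI_nonneg _) hn0.le) _)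
  set X := (infI K₀ / n) ^ β + (infI K₁ / n) ^ β with hXdef
  have hXroot : (X ^ (1 / β)) ^ β = X := by
    rw [← Real.rpow_mul hX, one_div_mul_cancel hβ0.ne', Real.rpow_one]
  rw [← hXroot]
  refine Real.rpow_le_rpow (Real.rpow_nonneg hX _) ?_ hβ0.le
  rw [le_div_iff₀ hn0]
  refine le_csInf ⟨_, LinearMap.id, LinearMap.det_id, rfl⟩ ?_
  rintro _ ⟨T, hT, rfl⟩
  rw [← le_div_iff₀ hn0, ← Real.rpow_le_rpow_iff (Real.rpow_nonneg hX _)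
    (div_nonneg (inertia_nonneg _) hn0.le) hβ0, hXroot]
  exact step T hT
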